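/- arXiv:2404.06630 — 3 statements merged into one kernel-verified Lean document; each statement's English description precedes it below -/
import Mathlib

section
/- Let (Ω, μ) be a measure space, K a finite index type, {D k}_{k ∈ K} measurable subsets of Ω that are pairwise μ-a.e. disjoint with union μ-a.e. equal to Ω, and M : K → Finset K with k ∈ M k for every k; set C k = {j ∈ K : k ∈ M j}. Suppose for each k ∈ K that Π k is a linear map on L²(Ω, μ) for which there is a subspace V k ⊆ L²(Ω, μ) with Π k u ∈ V k and (Π k u, v)_{M k} = (u, v)_{M k} for all v ∈ V k, where (u, v)_{M k} = ∑_{j ∈ M k} (1/|C j|) ∫_{D j} u·v dμ. Define the state redistribution operator S by letting Su equal (1/|C k|) ∑_{j ∈ C k} (Π j u) on each D k. Then S is contractive in L²: ‖S u‖_{L²(Ω, μ)} ≤ ‖u‖_{L²(Ω, μ)} for every u ∈ L²(Ω, μ). -/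
open MeasureTheory Finset

/-- The volume-weighted inner product over a merge neighborhood `Mset`:
`(u, v)_{M k} = ∑_{j ∈ Mset} (1/|C j|) ∫_{D j} u·v dμ`. -/
noncomputable def mergeInner {Ω : Type*} [MeasurableSpace Ω] {K : Type*}
    (μ : Measure Ω) (D : K → Set Ω) (C : K → Finset K) (Mset : Finset K)
    (u v : Ω → ℝ) : ℝ :=
  ∑ j ∈ Mset, (1 / ((C j).card : ℝ)) * ∫ x in D j, u x * v x ∂μ

theorem integrable_mul_of_Lp_two {Ω : Type*} [MeasurableSpace Ω] {μ : Measure Ω}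
    (f g : Lp ℝ 2 μ) : Integrable (fun x => f x * g x) μ :=
  (Lp.memLp f).integrable_mul (Lp.memLp g)

/-- The squared `L²` norm splits over an a.e. partition. -/
theorem sq_norm_eq_sum_setIntegral {Ω : Type*} [MeasurableSpace Ω] {μ : Measure Ω}
    {K : Type*} [Fintype K] {D : K → Set Ω} (hDmeas : ∀ k, MeasurableSet (D k))
    (hdisj : ∀ k l, k ≠ l → μ (D k ∩ D l) = 0) (hcover : μ ((⋃ k, D k)ᶜ) = 0)
    (f : Lp ℝ 2 μ) : ‖f‖ ^ 2 = ∑ k, ∫ x in D k, f x * f x ∂μ := by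
  have hf : ‖f‖ ^ 2 = ∫ x, f x * f x ∂μ := by
    rw [← real_inner_self_eq_norm_sq, L2.inner_def]
    rfl
  have hunion : (⋃ k, D k : Set Ω) =ᵐ[μ] Set.univ := Filter.eventuallyEq_univ.mpr hcover
  rw [hf, ← setIntegral_univ, ← setIntegral_congr_set hunion,
    integral_iUnion_ae (fun k => (hDmeas k).nullMeasurableSet)
      (fun k l hkl => hdisj k l hkl) (integrable_mul_of_Lp_two f f).integrableOn,
    tsum_fintype]

theorem two_mul_mergeInner_le {Ω : Type*} [MeasurableSpace Ω] {μ : Measure Ω}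
    {K : Type*} (D : K → Set Ω) (C : K → Finset K) (N : Finset K) (u v : Lp ℝ 2 μ) :
    2 * mergeInner μ D C N u v ≤ mergeInner μ D C N u u + mergeInner μ D C N v v := by
  unfold mergeInner
  rw [mul_sum, ← sum_add_distrib]
  refine sum_le_sum fun j _ => ?_
  have hle : 2 * ∫ x in D j, u x * v x ∂μ ≤
      (∫ x in D j, u x * u x ∂μ) + ∫ x in D j, v x * v x ∂μ := by
    have huu := (integrable_mul_of_Lp_two u u).integrableOn (s := D j)
    have hvv := (integrable_mul_of_Lp_two v v).integrableOn (s := D j)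
    rw [← integral_const_mul, ← integral_add huu hvv]
    refine integral_mono (((integrable_mul_of_Lp_two u v).integrableOn).const_mul 2)
      (huu.add hvv) fun x => ?_
    change 2 * (u x * v x) ≤ u x * u x + v x * v x
    nlinarith [sq_nonneg (u x - v x)]
  have hw : (0 : ℝ) ≤ 1 / ((C j).card : ℝ) := by positivity
  nlinarith [mul_le_mul_of_nonneg_left hle hw]

theorem sq_one_div_card_mul_sum_le {ι : Type*} (s : Finset ι) (a : ι → ℝ) :
    (1 / (s.card : ℝ) * ∑ j ∈ s, a j) ^ 2 ≤ 1 / (s.card : ℝ) * ∑ j ∈ s, a j ^ 2 := by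
  rcases s.eq_empty_or_nonempty with rfl | hs
  · simp
  have hcard : (0 : ℝ) < s.card := by exact_mod_cast hs.card_pos
  calc (1 / (s.card : ℝ) * ∑ j ∈ s, a j) ^ 2
      = (1 / (s.card : ℝ)) ^ 2 * (∑ j ∈ s, a j) ^ 2 := mul_pow _ _ _
    _ ≤ (1 / (s.card : ℝ)) ^ 2 * (s.card * ∑ j ∈ s, a j ^ 2) := by
        gcongr
        exact sq_sum_le_card_mul_sum_sq
    _ = 1 / (s.card : ℝ) * ∑ j ∈ s, a j ^ 2 := by field_simp

/-- Exchanging the sum over neighborhoods with the sum over elements. -/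
theorem sum_mergeInner_eq {Ω : Type*} [MeasurableSpace Ω] (μ : Measure Ω)
    {K : Type*} [Fintype K] (D : K → Set Ω) {M C : K → Finset K}
    (hC : ∀ k j, j ∈ C k ↔ k ∈ M j) (f g : K → Ω → ℝ) :
    ∑ j, mergeInner μ D C (M j) (f j) (g j) =
      ∑ k, 1 / ((C k).card : ℝ) * ∑ j ∈ C k, ∫ x in D k, f j x * g j x ∂μ := by
  simp only [mergeInner, mul_sum]
  exact sum_comm' fun j k => by simp [hC]

/-- State redistribution applied to an energy stable scheme: if each merge
projection `P k` conserves moments against a local approximation space `V k`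
in the volume-weighted inner product over its merge neighborhood, then the
state redistribution operator `S` is contractive in `L²`. -/
theorem stateRedistribution_contractive
    {Ω : Type*} [MeasurableSpace Ω] (μ : Measure Ω)
    {K : Type*} [Fintype K]
    (D : K → Set Ω) (hDmeas : ∀ k, MeasurableSet (D k))
    (hdisj : ∀ k l, k ≠ l → μ (D k ∩ D l) = 0)
    (hcover : μ ((⋃ k, D k)ᶜ) = 0)
    (M : K → Finset K) (hM : ∀ k, k ∈ M k)
    (C : K → Finset K) (hC : ∀ k j, j ∈ C k ↔ k ∈ M j)
    (P : K → (Lp ℝ 2 μ →ₗ[ℝ] Lp ℝ 2 μ))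
    (V : K → Submodule ℝ (Lp ℝ 2 μ))
    (hPV : ∀ k (w : Lp ℝ 2 μ), P k w ∈ V k)
    (hmom : ∀ k (w : Lp ℝ 2 μ), ∀ v ∈ V k,
      mergeInner μ D C (M k) (P k w) v = mergeInner μ D C (M k) w v)
    (u Su : Lp ℝ 2 μ)
    (hS : ∀ k, ∀ᵐ x ∂μ, x ∈ D k →
      Su x = (1 / ((C k).card : ℝ)) * ∑ j ∈ C k, (P j u) x) :
    ‖Su‖ ≤ ‖u‖ := by
  have hproj : ∀ k, mergeInner μ D C (M k) (P k u) (P k u) ≤ mergeInner μ D C (M k) u u := by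
    intro k
    have hle := two_mul_mergeInner_le D C (M k) u (P k u)
    rw [← hmom k u _ (hPV k u)] at hle
    linarith
  have haverage : ∀ k, ∫ x in D k, Su x * Su x ∂μ ≤
      1 / ((C k).card : ℝ) * ∑ j ∈ C k, ∫ x in D k, (P j u) x * (P j u) x ∂μ := by
    intro k
    have hint : ∀ j ∈ C k, Integrable (fun x => (P j u) x * (P j u) x) (μ.restrict (D k)) :=
      fun j _ => (integrable_mul_of_Lp_two (P j u) (P j u)).integrableOn
    rw [← integral_finsetSum _ hint, ← integral_const_mul]
    refine integral_mono_ae (integrable_mul_of_Lp_two Su Su).integrableOn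
      ((integrable_finsetSum _ hint).const_mul _) ?_
    filter_upwards [(ae_restrict_iff' (hDmeas k)).mpr (hS k)] with x hx
    rw [hx]
    simpa only [sq] using sq_one_div_card_mul_sum_le (C k) fun j => (P j u) x
  have hpartition : ∀ k, 1 / ((C k).card : ℝ) * ∑ _j ∈ C k, ∫ x in D k, u x * u x ∂μ =
      ∫ x in D k, u x * u x ∂μ := by
    intro k
    have hcard : ((C k).card : ℝ) ≠ 0 :=
      Nat.cast_ne_zero.mpr (card_ne_zero_of_mem ((hC k k).mpr (hM k)))
    rw [sum_const, nsmul_eq_mul]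
    field_simp
  refine (sq_le_sq₀ (norm_nonneg Su) (norm_nonneg u)).mp ?_
  calc ‖Su‖ ^ 2 = ∑ k, ∫ x in D k, Su x * Su x ∂μ :=
        sq_norm_eq_sum_setIntegral hDmeas hdisj hcover Su
    _ ≤ ∑ k, 1 / ((C k).card : ℝ) * ∑ j ∈ C k, ∫ x in D k, (P j u) x * (P j u) x ∂μ :=
        sum_le_sum fun k _ => haverage k
    _ = ∑ j, mergeInner μ D C (M j) (P j u) (P j u) :=
        (sum_mergeInner_eq μ D hC (fun j => P j u) fun j => P j u).symm
    _ ≤ ∑ j, mergeInner μ D C (M j) u u := sum_le_sum fun j _ => hproj j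
    _ = ∑ k, ∫ x in D k, u x * u x ∂μ := by
        rw [sum_mergeInner_eq μ D hC (fun _ => u) fun _ => u]
        exact sum_congr rfl fun k _ => hpartition k
    _ = ‖u‖ ^ 2 := (sq_norm_eq_sum_setIntegral hDmeas hdisj hcover u).symm
end

section
/- Let (Ω, μ) be a measure space, K a finite index type, {D k}_{k ∈ K} measurable subsets of Ω that are pairwise μ-a.e. disjoint with union μ-a.e. equal to Ω, and M : K → Finset K with k ∈ M k for every k; set C k = {j ∈ K : k ∈ M j}. Let u ∈ L²(Ω, μ) and for each k let Π k be a linear map on L²(Ω, μ) satisfying the weighted-norm contraction bound ‖Π k u‖²_{M k} ≤ ‖u‖²_{M k}, where ‖v‖²_{M k} = ∑_{j ∈ M k} (1/|C j|) ∫_{D j} v² dμ. Define Su to equal (1/|C k|) ∑_{j ∈ C k} (Π j u) on each D k. Then ‖S u‖_{L²(Ω, μ)} ≤ ‖u‖_{L²(Ω, μ)}. -/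
open MeasureTheory Finset

theorem sum_setIntegral_eq_integral_of_ae_partition {Ω : Type*} [MeasurableSpace Ω]
    {μ : Measure Ω} {K : Type*} [Fintype K] {D : K → Set Ω}
    (hDmeas : ∀ k, MeasurableSet (D k))
    (hdisj : Pairwise fun k l => AEDisjoint μ (D k) (D l))
    (hcover : μ ((⋃ k, D k)ᶜ) = 0) {f : Ω → ℝ} (hf : Integrable f μ) :
    ∑ k, ∫ x in D k, f x ∂μ = ∫ x, f x ∂μ := by
  have h := integral_iUnion_ae (fun k => (hDmeas k).nullMeasurableSet) hdisj hf.integrableOn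
  rw [tsum_fintype] at h
  rw [← h, Measure.restrict_eq_self_of_ae_mem (measure_eq_zero_iff_ae_notMem.mp hcover |>.mono
    fun x hx => not_not.mp hx)]

theorem MeasureTheory.Lp.integrable_mul_self {Ω : Type*} [MeasurableSpace Ω] {μ : Measure Ω}
    (f : Lp ℝ 2 μ) : Integrable (fun x => f x * f x) μ :=
  (Lp.memLp f).integrable_mul (Lp.memLp f)

theorem MeasureTheory.Lp.norm_sq_eq_integral_mul_self {Ω : Type*} [MeasurableSpace Ω]
    {μ : Measure Ω} (f : Lp ℝ 2 μ) : ‖f‖ ^ 2 = ∫ x, f x * f x ∂μ := by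
  rw [← real_inner_self_eq_norm_sq, L2.inner_def]
  simp [sq]

theorem sq_average_le_average_sq {ι : Type*} {s : Finset ι} (a : ι → ℝ) :
    ((1 / (s.card : ℝ)) * ∑ j ∈ s, a j) * ((1 / (s.card : ℝ)) * ∑ j ∈ s, a j) ≤
      (1 / (s.card : ℝ)) * ∑ j ∈ s, a j * a j := by
  rcases s.eq_empty_or_nonempty with rfl | hs
  · simp
  have hc : (0 : ℝ) < s.card := by exact_mod_cast hs.card_pos
  have h := sq_sum_le_card_mul_sum_sq (s := s) (f := a)
  simp only [sq] at h
  calc _ = (1 / (s.card : ℝ)) ^ 2 * ((∑ j ∈ s, a j) * ∑ j ∈ s, a j) := by ring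
    _ ≤ (1 / (s.card : ℝ)) ^ 2 * (s.card * ∑ j ∈ s, a j * a j) := by gcongr
    _ = _ := by field_simp

/-- Key intermediate form of the contractivity theorem: if each merge
projection `P k` is contractive in its own weighted merge-neighborhood
seminorm at `u`, then state redistribution is contractive in `L²` at `u`. -/
theorem stateRedistribution_contractive_of_weighted_contraction
    {Ω : Type*} [MeasurableSpace Ω] (μ : Measure Ω)
    {K : Type*} [Fintype K]
    (D : K → Set Ω) (hDmeas : ∀ k, MeasurableSet (D k))
    (hdisj : ∀ k l, k ≠ l → μ (D k ∩ D l) = 0)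
    (hcover : μ ((⋃ k, D k)ᶜ) = 0)
    (M : K → Finset K) (hM : ∀ k, k ∈ M k)
    (C : K → Finset K) (hC : ∀ k j, j ∈ C k ↔ k ∈ M j)
    (u : Lp ℝ 2 μ)
    (P : K → (Lp ℝ 2 μ →ₗ[ℝ] Lp ℝ 2 μ))
    (hcontr : ∀ k, mergeInner μ D C (M k) (P k u) (P k u)
      ≤ mergeInner μ D C (M k) u u)
    (Su : Lp ℝ 2 μ)
    (hS : ∀ k, ∀ᵐ x ∂μ, x ∈ D k →
      Su x = (1 / ((C k).card : ℝ)) * ∑ j ∈ C k, (P j u) x) :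
    ‖Su‖ ≤ ‖u‖ := by
  have hdisj' : Pairwise fun k l => AEDisjoint μ (D k) (D l) := fun k l hkl => hdisj k l hkl
  have hnorm (f : Lp ℝ 2 μ) : ‖f‖ ^ 2 = ∑ k, ∫ x in D k, f x * f x ∂μ := by
    rw [Lp.norm_sq_eq_integral_mul_self,
      sum_setIntegral_eq_integral_of_ae_partition hDmeas hdisj' hcover (Lp.integrable_mul_self f)]
  have hlocal (k : K) : ∫ x in D k, Su x * Su x ∂μ ≤
      ∑ j ∈ C k, (1 / ((C k).card : ℝ)) * ∫ x in D k, (P j u) x * (P j u) x ∂μ := by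
    have hint : ∀ j ∈ C k, Integrable (fun x => (P j u) x * (P j u) x) (μ.restrict (D k)) :=
      fun j _ => (Lp.integrable_mul_self (P j u)).restrict
    rw [← Finset.mul_sum, ← integral_finsetSum _ hint, ← integral_const_mul]
    refine integral_mono_ae (Lp.integrable_mul_self Su).restrict
      ((integrable_finsetSum _ hint).const_mul _) ?_
    filter_upwards [(ae_restrict_iff' (hDmeas k)).mpr (hS k)] with x hx
    rw [hx]
    exact sq_average_le_average_sq _
  have hswap (F : K → K → ℝ) : ∑ k, ∑ j ∈ C k, F k j = ∑ j, ∑ k ∈ M j, F k j :=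
    Finset.sum_comm' fun k j => by simp [hC]
  refine (sq_le_sq₀ (norm_nonneg _) (norm_nonneg _)).mp ?_
  calc ‖Su‖ ^ 2 = ∑ k, ∫ x in D k, Su x * Su x ∂μ := hnorm Su
    _ ≤ ∑ k, ∑ j ∈ C k, (1 / ((C k).card : ℝ)) * ∫ x in D k, (P j u) x * (P j u) x ∂μ :=
      Finset.sum_le_sum fun k _ => hlocal k
    _ = ∑ j, mergeInner μ D C (M j) (P j u) (P j u) := hswap _
    _ ≤ ∑ j, mergeInner μ D C (M j) u u := Finset.sum_le_sum fun j _ => hcontr j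
    _ = ∑ k, ∑ _j ∈ C k, (1 / ((C k).card : ℝ)) * ∫ x in D k, u x * u x ∂μ := (hswap _).symm
    _ = ∑ k, ∫ x in D k, u x * u x ∂μ := by
      refine Finset.sum_congr rfl fun k _ => ?_
      have hc : ((C k).card : ℝ) ≠ 0 :=
        Nat.cast_ne_zero.mpr (Finset.card_ne_zero_of_mem ((hC k k).mpr (hM k)))
      rw [Finset.sum_const, nsmul_eq_mul]
      field_simp
    _ = ‖u‖ ^ 2 := (hnorm u).symm
end

section
/- (Conservation of the solution average by state redistribution) Let (Ω, μ) be a finite measure space, K a finite index type, {D k}_{k ∈ K} measurable subsets of Ω that are pairwise μ-a.e. disjoint with union μ-a.e. equal to Ω, and M : K → Finset K with k ∈ M k for every k; set C k = {j ∈ K : k ∈ M j}. Let u ∈ L²(Ω, μ) and for each k let Π k be a linear map on L²(Ω, μ) satisfying the moment-conservation condition against constants: (Π k u, 1)_{M k} = (u, 1)_{M k}, where (w, v)_{M k} = ∑_{j ∈ M k} (1/|C j|) ∫_{D j} w·v dμ and 1 denotes the constant function one. Define Su to equal (1/|C k|) ∑_{j ∈ C k} (Π j u) on each D k. Then ∫_Ω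 S u dμ = ∫_Ω u dμ. -/
open MeasureTheory Finset

/-- The integral over the whole space is the sum of the integrals over the elements of a finite
almost everywhere partition. -/
theorem integral_eq_sum_setIntegral_of_ae_partition {Ω K : Type*} [MeasurableSpace Ω] [Fintype K]
    {μ : Measure Ω} {D : K → Set Ω} (hDmeas : ∀ k, MeasurableSet (D k))
    (hdisj : ∀ k l, k ≠ l → μ (D k ∩ D l) = 0) (hcover : μ ((⋃ k, D k)ᶜ) = 0)
    {f : Ω → ℝ} (hf : Integrable f μ) :
    ∫ x, f x ∂μ = ∑ k, ∫ x in D k, f x ∂μ := by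
  rw [integral_eq_setIntegral (s := ⋃ k, D k) hcover,
    integral_iUnion_ae (fun k => (hDmeas k).nullMeasurableSet) (fun k l h => hdisj k l h)
      hf.integrableOn, tsum_fintype]

/-- Summing the merge-neighborhood moments over all neighborhoods regroups them by element. -/
theorem sum_mergeInner_one {Ω K : Type*} [MeasurableSpace Ω] [Fintype K]
    (μ : Measure Ω) (D : K → Set Ω) {M C : K → Finset K}
    (hC : ∀ k j, j ∈ C k ↔ k ∈ M j) (f : K → Ω → ℝ) :
    ∑ j, mergeInner μ D C (M j) (f j) (fun _ => 1)
      = ∑ k, (1 / ((C k).card : ℝ)) * ∑ j ∈ C k, ∫ x in D k, f j x ∂μ := by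
  simp only [mergeInner, mul_one, Finset.mul_sum]
  exact Finset.sum_comm' fun j k => by simp [hC]

/-- Conservation of the solution average by state redistribution: if each merge
projection `P k` conserves moments against the constant function one in the
weighted inner product over its merge neighborhood, then state redistribution
preserves the integral of the solution. -/
theorem stateRedistribution_conserves_average
    {Ω : Type*} [MeasurableSpace Ω] (μ : Measure Ω) [IsFiniteMeasure μ]
    {K : Type*} [Fintype K]
    (D : K → Set Ω) (hDmeas : ∀ k, MeasurableSet (D k))
    (hdisj : ∀ k l, k ≠ l → μ (D k ∩ D l) = 0)
    (hcover : μ ((⋃ k, D k)ᶜ) = 0)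
    (M : K → Finset K) (hM : ∀ k, k ∈ M k)
    (C : K → Finset K) (hC : ∀ k j, j ∈ C k ↔ k ∈ M j)
    (u : Lp ℝ 2 μ)
    (P : K → (Lp ℝ 2 μ →ₗ[ℝ] Lp ℝ 2 μ))
    (hmom : ∀ k, mergeInner μ D C (M k) (P k u) (fun _ => 1)
      = mergeInner μ D C (M k) u (fun _ => 1))
    (Su : Lp ℝ 2 μ)
    (hS : ∀ k, ∀ᵐ x ∂μ, x ∈ D k →
      Su x = (1 / ((C k).card : ℝ)) * ∑ j ∈ C k, (P j u) x) :
    ∫ x, Su x ∂μ = ∫ x, u x ∂μ := by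
  have integrable_Lp (f : Lp ℝ 2 μ) : Integrable f μ := (Lp.memLp f).integrable one_le_two
  have hcard (k : K) : ((C k).card : ℝ) ≠ 0 :=
    Nat.cast_ne_zero.mpr (Finset.card_ne_zero_of_mem ((hC k k).mpr (hM k)))
  calc ∫ x, Su x ∂μ
      = ∑ k, ∫ x in D k, Su x ∂μ :=
        integral_eq_sum_setIntegral_of_ae_partition hDmeas hdisj hcover (integrable_Lp Su)
    _ = ∑ k, (1 / ((C k).card : ℝ)) * ∑ j ∈ C k, ∫ x in D k, (P j u) x ∂μ := by
        refine Finset.sum_congr rfl fun k _ => ?_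
        rw [setIntegral_congr_ae (hDmeas k) (hS k), integral_const_mul,
          integral_finsetSum _ fun j _ => (integrable_Lp (P j u)).integrableOn]
    _ = ∑ j, mergeInner μ D C (M j) u (fun _ => 1) := by
        rw [← sum_mergeInner_one μ D hC fun j => P j u]
        exact Finset.sum_congr rfl fun j _ => hmom j
    _ = ∑ k, ∫ x in D k, u x ∂μ := by
        rw [sum_mergeInner_one μ D hC fun _ => u]
        refine Finset.sum_congr rfl fun k _ => ?_
        rw [Finset.sum_const, nsmul_eq_mul, ← mul_assoc, one_div_mul_cancel (hcard k), one_mul]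
    _ = ∫ x, u x ∂μ :=
        (integral_eq_sum_setIntegral_of_ae_partition hDmeas hdisj hcover (integrable_Lp u)).symm
end
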